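/- The pushforward of the two-dimensional Lebesgue measure on the unit square [0,1] × [0,1] under the map (x, y) ↦ (min(x,y), |x − y|) is equal to 2 times the Lebesgue measure restricted to the open triangle {(u, v) ∈ ℝ² : u > 0, v > 0, u + v < 1}. -/

import Mathlib

open MeasureTheory

/-- A left inverse `f` of a measure-preserving map `e` on the preimage of `A` pushes the restriction
of the measure to `A` forward to its restriction to that preimage. -/
theorem map_restrict_of_leftInvOn {α : Type*} [MeasurableSpace α] {μ : Measure α} {e f : α → α}
    {A : Set α} (he : MeasurePreserving e μ μ) (hf : Measurable f) (hA : MeasurableSet A)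
    (hfe : Set.LeftInvOn f e (e ⁻¹' A)) :
    Measure.map f (μ.restrict A) = μ.restrict (e ⁻¹' A) := by
  rw [← (he.restrict_preimage hA).map_eq, Measure.map_map hf he.measurable]
  have h : f ∘ e =ᵐ[μ.restrict (e ⁻¹' A)] id :=
    (ae_restrict_mem (he.measurable hA)).mono fun q hq => hfe hq
  rw [Measure.map_congr h, Measure.map_id]

theorem measurePreserving_shear :
    MeasurePreserving (fun p : ℝ × ℝ => (p.1, p.1 + p.2)) volume volume :=
  measurePreserving_prod_add volume volume

theorem volume_diagonal_real : volume {p : ℝ × ℝ | p.1 = p.2} = 0 := by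
  have hm : MeasurableSet {p : ℝ × ℝ | p.1 = p.2} :=
    measurableSet_eq_fun measurable_fst measurable_snd
  rw [← measurePreserving_shear.measure_preimage hm.nullMeasurableSet]
  have h : (fun p : ℝ × ℝ => (p.1, p.1 + p.2)) ⁻¹' {p : ℝ × ℝ | p.1 = p.2} =
      Set.univ ×ˢ {0} := by
    ext p
    simp
  rw [h, Measure.volume_eq_prod, Measure.prod_prod]
  simp

theorem measurableSet_lt_triangle : MeasurableSet {p : ℝ × ℝ | 0 < p.1 ∧ p.1 < p.2 ∧ p.2 < 1} :=
  (measurableSet_lt measurable_const measurable_fst).inter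
    ((measurableSet_lt measurable_fst measurable_snd).inter
      (measurableSet_lt measurable_snd measurable_const))

theorem measurableSet_gt_triangle : MeasurableSet {p : ℝ × ℝ | 0 < p.2 ∧ p.2 < p.1 ∧ p.1 < 1} :=
  measurable_swap measurableSet_lt_triangle

theorem restrict_unit_square_eq_add :
    (volume : Measure (ℝ × ℝ)).restrict (Set.Icc (0 : ℝ) 1 ×ˢ Set.Icc (0 : ℝ) 1) =
      volume.restrict {p : ℝ × ℝ | 0 < p.1 ∧ p.1 < p.2 ∧ p.2 < 1} +
        volume.restrict {p : ℝ × ℝ | 0 < p.2 ∧ p.2 < p.1 ∧ p.1 < 1} := by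
  rw [← Measure.restrict_union _ measurableSet_gt_triangle]
  · have hopen : (Set.Ioo (0 : ℝ) 1 ×ˢ Set.Ioo (0 : ℝ) 1 : Set (ℝ × ℝ)) =ᵐ[volume]
        Set.Icc (0 : ℝ) 1 ×ˢ Set.Icc (0 : ℝ) 1 :=
      Measure.set_prod_ae_eq Ioo_ae_eq_Icc Ioo_ae_eq_Icc
    refine Measure.restrict_congr_set (hopen.symm.trans ?_)
    have hdiag : ∀ᵐ p : ℝ × ℝ, p.1 ≠ p.2 := by
      simpa [ae_iff] using volume_diagonal_real
    filter_upwards [hdiag] with p hp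
    refine propext ?_
    change (p ∈ Set.Ioo (0 : ℝ) 1 ×ˢ Set.Ioo (0 : ℝ) 1) ↔
      (0 < p.1 ∧ p.1 < p.2 ∧ p.2 < 1) ∨ (0 < p.2 ∧ p.2 < p.1 ∧ p.1 < 1)
    simp only [Set.mem_prod, Set.mem_Ioo]
    grind
  · exact Set.disjoint_left.2 fun p hp hq => lt_asymm hp.2.1 hq.2.1

theorem pushforward_breakpoints_uniform_on_simplex :
    Measure.map (fun p : ℝ × ℝ => (min p.1 p.2, |p.1 - p.2|))
        (volume.restrict (Set.Icc (0:ℝ) 1 ×ˢ Set.Icc (0:ℝ) 1)) =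
      2 • volume.restrict {q : ℝ × ℝ | 0 < q.1 ∧ 0 < q.2 ∧ q.1 + q.2 < 1} := by
  have hf : Measurable (fun p : ℝ × ℝ => (min p.1 p.2, |p.1 - p.2|)) :=
    Continuous.measurable (by fun_prop)
  have hswap : MeasurePreserving (Prod.swap : ℝ × ℝ → ℝ × ℝ) volume volume :=
    Measure.measurePreserving_swap
  have hlt : (fun p : ℝ × ℝ => (p.1, p.1 + p.2)) ⁻¹' {p | 0 < p.1 ∧ p.1 < p.2 ∧ p.2 < 1} =
      {q : ℝ × ℝ | 0 < q.1 ∧ 0 < q.2 ∧ q.1 + q.2 < 1} := by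
    ext p
    simp
  have hgt : (Prod.swap ∘ fun p : ℝ × ℝ => (p.1, p.1 + p.2)) ⁻¹'
      {p | 0 < p.2 ∧ p.2 < p.1 ∧ p.1 < 1} =
      {q : ℝ × ℝ | 0 < q.1 ∧ 0 < q.2 ∧ q.1 + q.2 < 1} := by
    ext p
    simp
  rw [restrict_unit_square_eq_add, Measure.map_add _ _ hf,
    map_restrict_of_leftInvOn measurePreserving_shear hf measurableSet_lt_triangle,
    map_restrict_of_leftInvOn (hswap.comp measurePreserving_shear) hf measurableSet_gt_triangle,
    hlt, hgt, two_smul]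
  · rw [hgt]
    rintro ⟨u, v⟩ ⟨-, hv, -⟩
    have hv : 0 < v := hv
    simp [hv.le, abs_of_pos hv]
  · rw [hlt]
    rintro ⟨u, v⟩ ⟨-, hv, -⟩
    have hv : 0 < v := hv
    simp [hv.le, abs_of_pos hv]
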